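/- arXiv:1711.03896 — 4 statements merged into one kernel-verified Lean document; each statement's English description precedes it below -/
import Mathlib

section
/- Let Φ = (0,0,1,0,0,0) ∈ ℝ⁶ (a revolute joint about the z-axis) and let π = (m, h_x, h_y, h_z, I_xx, I_xy, I_xz, I_yy, I_yz, I_zz) ∈ ℝ^10. Then (Φ×)ᵀ·[π]^∧ + [π]^∧·(Φ×) = 0 if and only if h_x = h_y = I_xy = I_xz = I_yz = 0 and I_xx = I_yy. (This is the invariance condition for a revolute joint, equation (17) of the paper, satisfied exactly by mass distributions symmetric about the rotation axis.) -/
open Matrix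

noncomputable section

/-- 3×3 skew-symmetric cross-product matrix `S(x)`, satisfying `S(x) y = x × y`. -/
def skew3 (x : Fin 3 → ℝ) : Matrix (Fin 3) (Fin 3) ℝ :=
  !![0, -x 2, x 1; x 2, 0, -x 0; -x 1, x 0, 0]

/-- The angular (top) part of a 6D spatial vector. -/
def angPart (v : Fin 6 → ℝ) : Fin 3 → ℝ := fun i => v ⟨i, by omega⟩

/-- The linear (bottom) part of a 6D spatial vector. -/
def linPart (v : Fin 6 → ℝ) : Fin 3 → ℝ := fun i => v ⟨(i : ℕ) + 3, by omega⟩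

/-- 6×6 spatial cross-product matrix `(v×) = [[S(ω), 0], [S(u), S(ω)]]`. -/
def spCross (v : Fin 6 → ℝ) : Matrix (Fin 6) (Fin 6) ℝ :=
  Matrix.reindex (finSumFinEquiv : Fin 3 ⊕ Fin 3 ≃ Fin 6)
    (finSumFinEquiv : Fin 3 ⊕ Fin 3 ≃ Fin 6)
    (Matrix.fromBlocks (skew3 (angPart v)) 0 (skew3 (linPart v)) (skew3 (angPart v)))

/-- Spatial inertia matrix `[π]^∧ = [[Ī, S(h)], [S(h)ᵀ, m·1₃]]` built from the ten
inertial parameters `π = (m, hx, hy, hz, Ixx, Ixy, Ixz, Iyy, Iyz, Izz)`. -/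
def wedge (π : Fin 10 → ℝ) : Matrix (Fin 6) (Fin 6) ℝ :=
  Matrix.reindex (finSumFinEquiv : Fin 3 ⊕ Fin 3 ≃ Fin 6)
    (finSumFinEquiv : Fin 3 ⊕ Fin 3 ≃ Fin 6)
    (Matrix.fromBlocks !![π 4, π 5, π 6; π 5, π 7, π 8; π 6, π 8, π 9]
      (skew3 ![π 1, π 2, π 3]) (skew3 ![π 1, π 2, π 3])ᵀ
      (π 0 • (1 : Matrix (Fin 3) (Fin 3) ℝ)))

/-- Invariance condition for a revolute joint about the z-axis: with
`Φ = (0,0,1,0,0,0)`, `(Φ×)ᵀ·[π]^∧ + [π]^∧·(Φ×) = 0` iff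
`hx = hy = Ixy = Ixz = Iyz = 0` and `Ixx = Iyy`. -/
theorem revolute_invariance_condition (π : Fin 10 → ℝ) :
    (spCross ![0, 0, 1, 0, 0, 0])ᵀ * wedge π + wedge π * spCross ![0, 0, 1, 0, 0, 0] = 0 ↔
      (π 1 = 0 ∧ π 2 = 0 ∧ π 5 = 0 ∧ π 6 = 0 ∧ π 8 = 0 ∧ π 4 = π 7) := by
  rw [spCross, wedge]
  simp only [reindex_apply, transpose_submatrix, submatrix_mul_equiv,
    fromBlocks_transpose, fromBlocks_multiply]
  constructor
  · intro h
    have entry (i j : Fin 3 ⊕ Fin 3) := congrFun₂ h (finSumFinEquiv i) (finSumFinEquiv j)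
    have hxx := entry (.inl 0) (.inl 0)
    have hxy := entry (.inl 0) (.inl 1)
    have hxz := entry (.inl 0) (.inl 2)
    have hyz := entry (.inl 1) (.inl 2)
    have hx := entry (.inl 0) (.inr 2)
    have hy := entry (.inl 1) (.inr 2)
    simp [skew3, angPart, linPart, Matrix.mul_apply, Fin.sum_univ_three] at hxx hxy hxz hyz hx hy
    refine ⟨?_, ?_, ?_, ?_, ?_, ?_⟩ <;> linarith
  · rintro ⟨hx, hy, hxy, hxz, hyz, hxx⟩
    ext i j
    obtain ⟨i, rfl⟩ := (finSumFinEquiv : Fin 3 ⊕ Fin 3 ≃ Fin 6).surjective i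
    obtain ⟨j, rfl⟩ := (finSumFinEquiv : Fin 3 ⊕ Fin 3 ≃ Fin 6).surjective j
    rcases i with i | i <;> rcases j with j | j <;> fin_cases i <;> fin_cases j <;>
      simp [skew3, angPart, linPart, Matrix.mul_apply, Fin.sum_univ_three,
        hx, hy, hxy, hxz, hyz, hxx]
end
end

section
/- Let Φ = (0,0,1,0,0,0) ∈ ℝ⁶ (a revolute joint about the z-axis). Then the set {π ∈ ℝ^10 : Φᵀ·[π]^∧ = 0 and (Φ×)ᵀ·[π]^∧ + [π]^∧·(Φ×) = 0} equals {(m, 0, 0, h_z, a, 0, 0, a, 0, 0) : m, h_z, a ∈ ℝ}; in particular it is a subspace of ℝ^10 of dimension 3, spanned by changes in mass m, in the axial first moment h_z, and in the equal pair I_xx = I_yy. (This is the paper's computation of the three transfer degrees of freedom across a revolute joint.) -/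
open Matrix

noncomputable section

theorem wedge_eq (π : Fin 10 → ℝ) :
    wedge π = !![π 4, π 5, π 6, 0, -π 3, π 2;
      π 5, π 7, π 8, π 3, 0, -π 1;
      π 6, π 8, π 9, -π 2, π 1, 0;
      0, π 3, -π 2, π 0, 0, 0;
      -π 3, 0, π 1, 0, π 0, 0;
      π 2, -π 1, 0, 0, 0, π 0] := by
  ext i j
  fin_cases i <;> fin_cases j <;>
    simp [wedge, finSumFinEquiv, Fin.addCases, skew3, Fin.subNat, Fin.castLT]

theorem spCross_revolute :
    spCross ![0, 0, 1, 0, 0, 0] = !![0, -1, 0, 0, 0, 0;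
      1, 0, 0, 0, 0, 0;
      0, 0, 0, 0, 0, 0;
      0, 0, 0, 0, -1, 0;
      0, 0, 0, 1, 0, 0;
      0, 0, 0, 0, 0, 0] := by
  ext i j
  fin_cases i <;> fin_cases j <;>
    simp [spCross, angPart, linPart, finSumFinEquiv, Fin.addCases, skew3, Fin.subNat, Fin.castLT]

/-- The parametrization `(m, h_z, a) ↦ (m, 0, 0, h_z, a, 0, 0, a, 0, 0)`. -/
def revoluteParam : (Fin 3 → ℝ) →ₗ[ℝ] (Fin 10 → ℝ) where
  toFun x := ![x 0, 0, 0, x 1, x 2, 0, 0, x 2, 0, 0]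
  map_add' x y := by simp
  map_smul' c x := by simp

theorem revoluteParam_injective : Function.Injective revoluteParam := by
  intro x y h
  ext i
  fin_cases i
  · exact congrFun h 0
  · exact congrFun h 3
  · exact congrFun h 4

theorem coe_range_revoluteParam :
    (LinearMap.range revoluteParam : Set (Fin 10 → ℝ)) =
      {π | ∃ m hz a : ℝ, π = ![m, 0, 0, hz, a, 0, 0, a, 0, 0]} := by
  ext π
  constructor
  · rintro ⟨x, rfl⟩
    exact ⟨x 0, x 1, x 2, rfl⟩
  · rintro ⟨m, hz, a, rfl⟩
    exact ⟨![m, hz, a], rfl⟩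

theorem revolute_conditions_iff (π : Fin 10 → ℝ) :
    ((![0, 0, 1, 0, 0, 0] : Fin 6 → ℝ) ᵥ* wedge π = 0 ∧
        (spCross ![0, 0, 1, 0, 0, 0])ᵀ * wedge π
          + wedge π * spCross ![0, 0, 1, 0, 0, 0] = 0) ↔
      ∃ m hz a : ℝ, π = ![m, 0, 0, hz, a, 0, 0, a, 0, 0] := by
  rw [spCross_revolute, wedge_eq]
  constructor
  · rintro ⟨hmom, hinv⟩
    have h6 := congrFun hmom 0
    have h8 := congrFun hmom 1
    have h9 := congrFun hmom 2
    have h2 := congrFun hmom 3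
    have h1 := congrFun hmom 4
    have h5 := congrFun (congrFun hinv 0) 0
    have h47 := congrFun (congrFun hinv 0) 1
    simp [Matrix.vecMul, dotProduct, Matrix.mul_apply, Fin.sum_univ_succ]
      at h6 h8 h9 h2 h1 h5 h47
    refine ⟨π 0, π 3, π 4, ?_⟩
    ext i
    fin_cases i <;> simp <;> linarith
  · rintro ⟨m, hz, a, rfl⟩
    constructor
    · ext j
      fin_cases j <;> simp [Matrix.vecMul, dotProduct, Fin.sum_univ_succ]
    · ext i j
      fin_cases i <;> fin_cases j <;> simp [Matrix.mul_apply, Fin.sum_univ_succ]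

/-- The undetectable transfer freedoms across a revolute joint about the z-axis:
the parameters satisfying both the momentum condition `Φᵀ·[π]^∧ = 0` and the
invariance condition `(Φ×)ᵀ·[π]^∧ + [π]^∧·(Φ×) = 0` are exactly those of the form
`(m, 0, 0, h_z, a, 0, 0, a, 0, 0)`; in particular they form a subspace of `ℝ^10`
of dimension 3. -/
theorem revolute_transfer_freedoms :
    ({π : Fin 10 → ℝ | (![0, 0, 1, 0, 0, 0] : Fin 6 → ℝ) ᵥ* wedge π = 0 ∧
        (spCross ![0, 0, 1, 0, 0, 0])ᵀ * wedge π
          + wedge π * spCross ![0, 0, 1, 0, 0, 0] = 0}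
      = {π : Fin 10 → ℝ | ∃ m hz a : ℝ, π = ![m, 0, 0, hz, a, 0, 0, a, 0, 0]}) ∧
    ∃ U : Submodule ℝ (Fin 10 → ℝ),
      (↑U = {π : Fin 10 → ℝ | (![0, 0, 1, 0, 0, 0] : Fin 6 → ℝ) ᵥ* wedge π = 0 ∧
        (spCross ![0, 0, 1, 0, 0, 0])ᵀ * wedge π
          + wedge π * spCross ![0, 0, 1, 0, 0, 0] = 0}) ∧
      Module.finrank ℝ U = 3 := by
  have hset := Set.ext revolute_conditions_iff
  refine ⟨hset, LinearMap.range revoluteParam, coe_range_revoluteParam.trans hset.symm, ?_⟩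
  rw [LinearMap.finrank_range_of_inj revoluteParam_injective, Module.finrank_fin_fun]
end
end

section
/- For every Φ ∈ ℝ⁶ there exists a unique linear map A(Φ) : ℝ^10 → ℝ^10 such that [A(Φ)·π]^∧ = (Φ×)ᵀ·[π]^∧ + [π]^∧·(Φ×) for all π ∈ ℝ^10; equivalently, the image of the spatial-inertia map π ↦ [π]^∧ is invariant under the operator M ↦ (Φ×)ᵀM + M(Φ×). (This is the well-definedness of the parameter-rate matrix A(Φ) in equation (34) of the paper.) -/
open Matrix

noncomputable section

theorem spCross_eq (v : Fin 6 → ℝ) :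
    spCross v =
      !![0, -v 2, v 1, 0, 0, 0;
         v 2, 0, -v 0, 0, 0, 0;
         -v 1, v 0, 0, 0, 0, 0;
         0, -v 5, v 4, 0, -v 2, v 1;
         v 5, 0, -v 3, v 2, 0, -v 0;
         -v 4, v 3, 0, -v 1, v 0, 0] := by
  ext i j
  rw [spCross, Matrix.reindex_apply, Matrix.submatrix_apply]
  obtain ⟨i, rfl⟩ := (finSumFinEquiv : Fin 3 ⊕ Fin 3 ≃ Fin 6).surjective i
  obtain ⟨j, rfl⟩ := (finSumFinEquiv : Fin 3 ⊕ Fin 3 ≃ Fin 6).surjective j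
  simp only [Equiv.symm_apply_apply]
  rcases i with i | i <;> rcases j with j | j <;> fin_cases i <;> fin_cases j <;>
    simp [skew3, angPart, linPart] <;> rfl

/-- The inertial parameters read off from the entries of a spatial inertia matrix. -/
def vee : Matrix (Fin 6) (Fin 6) ℝ →ₗ[ℝ] (Fin 10 → ℝ) where
  toFun M := ![M 3 3, M 2 4, M 0 5, M 1 3, M 0 0, M 0 1, M 0 2, M 1 1, M 1 2, M 2 2]
  map_add' M N := by simp
  map_smul' c M := by simp

theorem wedge_vee (M : Matrix (Fin 6) (Fin 6) ℝ) :
    wedge (vee M) =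
      !![M 0 0, M 0 1, M 0 2, 0, -M 1 3, M 0 5;
         M 0 1, M 1 1, M 1 2, M 1 3, 0, -M 2 4;
         M 0 2, M 1 2, M 2 2, -M 0 5, M 2 4, 0;
         0, M 1 3, -M 0 5, M 3 3, 0, 0;
         -M 1 3, 0, M 2 4, 0, M 3 3, 0;
         M 0 5, -M 2 4, 0, 0, 0, M 3 3] :=
  wedge_eq (vee M)

theorem vee_wedge (π : Fin 10 → ℝ) : vee (wedge π) = π := by
  rw [wedge_eq]
  ext i
  fin_cases i <;> rfl

theorem wedge_injective : Function.Injective wedge :=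
  Function.LeftInverse.injective vee_wedge

/-- The spatial-inertia map as a linear map. -/
def wedgeLinear : (Fin 10 → ℝ) →ₗ[ℝ] Matrix (Fin 6) (Fin 6) ℝ where
  toFun := wedge
  map_add' π ρ := by
    simp only [wedge_eq]
    ext i j
    fin_cases i <;> fin_cases j <;> simp <;> ring
  map_smul' c π := by
    simp only [wedge_eq]
    ext i j
    fin_cases i <;> fin_cases j <;> simp

set_option maxHeartbeats 2000000 in
/-- The spatial-inertia map has an image invariant under `M ↦ (Φ×)ᵀM + M(Φ×)`. -/
theorem wedge_vee_rate (Φ : Fin 6 → ℝ) (π : Fin 10 → ℝ) :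
    wedge (vee ((spCross Φ)ᵀ * wedge π + wedge π * spCross Φ)) =
      (spCross Φ)ᵀ * wedge π + wedge π * spCross Φ := by
  rw [wedge_vee, wedge_eq, spCross_eq]
  ext i j
  fin_cases i <;> fin_cases j <;>
    simp [Matrix.mul_apply, Fin.sum_univ_six] <;> try ring

/-- Well-definedness of the parameter-rate matrix `A(Φ)`: for every `Φ ∈ ℝ⁶` there is a
unique linear map `A(Φ) : ℝ^10 → ℝ^10` with
`[A(Φ)·π]^∧ = (Φ×)ᵀ·[π]^∧ + [π]^∧·(Φ×)` for all `π`; equivalently, the image of the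
spatial-inertia map is invariant under `M ↦ (Φ×)ᵀM + M(Φ×)`. -/
theorem parameter_rate_map_wellDefined (Φ : Fin 6 → ℝ) :
    ∃! A : (Fin 10 → ℝ) →ₗ[ℝ] (Fin 10 → ℝ),
      ∀ π : Fin 10 → ℝ,
        wedge (A π) = (spCross Φ)ᵀ * wedge π + wedge π * spCross Φ := by
  refine ⟨vee ∘ₗ (LinearMap.mulLeft ℝ (spCross Φ)ᵀ + LinearMap.mulRight ℝ (spCross Φ)) ∘ₗ
    wedgeLinear, wedge_vee_rate Φ, fun B hB => LinearMap.ext fun π => wedge_injective ?_⟩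
  exact (hB π).trans (wedge_vee_rate Φ π).symm
end
end

section
/- Let R ∈ SO(3) and p ∈ ℝ³, and let X ∈ ℝ^{6×6} be the spatial transform X = [[R, 0],[-R·S(p), R]]. Then for every π ∈ ℝ^10 there exists a unique π' ∈ ℝ^10 with [π']^∧ = Xᵀ·[π]^∧·X, and the map B(Xᵀ) : π ↦ π' is linear; equivalently, the image of the spatial-inertia map π ↦ [π]^∧ is invariant under congruence by spatial transforms. (This is the well-definedness of the parameter-transfer matrix B(Xᵀ) used throughout Section 5 of the paper.) -/
open Matrix

noncomputable section

theorem skew3_transpose (x : Fin 3 → ℝ) : (skew3 x)ᵀ = -skew3 x := by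
  ext i j
  fin_cases i <;> fin_cases j <;> simp [skew3]

theorem exists_skew3_eq {A : Matrix (Fin 3) (Fin 3) ℝ} (hA : Aᵀ = -A) :
    ∃ x, skew3 x = A := by
  refine ⟨![A 2 1, A 0 2, A 1 0], ?_⟩
  have h (i j : Fin 3) : A j i = -A i j := congrFun (congrFun hA i) j
  ext i j
  fin_cases i <;> fin_cases j <;> simp [skew3] <;>
    linarith [h 0 0, h 0 1, h 0 2, h 1 1, h 1 2, h 2 2]

theorem wedge_add (π π' : Fin 10 → ℝ) : wedge (π + π') = wedge π + wedge π' := by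
  ext i j
  obtain ⟨i | i, rfl⟩ := (finSumFinEquiv (m := 3) (n := 3)).surjective i <;>
  obtain ⟨j | j, rfl⟩ := (finSumFinEquiv (m := 3) (n := 3)).surjective j <;>
  simp only [wedge, reindex_apply, submatrix_apply, Equiv.symm_apply_apply, Matrix.add_apply,
    fromBlocks_apply₁₁, fromBlocks_apply₁₂, fromBlocks_apply₂₁,
    fromBlocks_apply₂₂] <;>
  fin_cases i <;> fin_cases j <;> simp [skew3] <;> ring

theorem wedge_smul (c : ℝ) (π : Fin 10 → ℝ) : wedge (c • π) = c • wedge π := by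
  ext i j
  obtain ⟨i | i, rfl⟩ := (finSumFinEquiv (m := 3) (n := 3)).surjective i <;>
  obtain ⟨j | j, rfl⟩ := (finSumFinEquiv (m := 3) (n := 3)).surjective j <;>
  simp only [wedge, reindex_apply, submatrix_apply, Equiv.symm_apply_apply,
    Matrix.smul_apply, fromBlocks_apply₁₁, fromBlocks_apply₁₂, fromBlocks_apply₂₁,
    fromBlocks_apply₂₂] <;>
  fin_cases i <;> fin_cases j <;> simp [skew3]

/-- Block characterization of the range of `wedge`. -/
theorem exists_wedge_eq {A B : Matrix (Fin 3) (Fin 3) ℝ} (m : ℝ) (hA : A.IsSymm)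
    (hB : Bᵀ = -B) :
    ∃ π, wedge π = reindex finSumFinEquiv finSumFinEquiv (fromBlocks A B Bᵀ (m • 1)) := by
  obtain ⟨h, rfl⟩ := exists_skew3_eq hB
  refine ⟨![m, h 0, h 1, h 2, A 0 0, A 0 1, A 0 2, A 1 1, A 1 2, A 2 2], ?_⟩
  have hh : ![h 0, h 1, h 2] = h := by
    ext i
    fin_cases i <;> rfl
  have hI : !![A 0 0, A 0 1, A 0 2; A 0 1, A 1 1, A 1 2; A 0 2, A 1 2, A 2 2] = A := by
    ext i j
    fin_cases i <;> fin_cases j <;> simp [hA.apply 0 1, hA.apply 0 2, hA.apply 1 2]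
  conv_rhs => rw [← hI, ← hh]
  rfl

/-- The range of `wedge` is invariant under congruence by spatial transforms. -/
theorem exists_wedge_eq_congruence {R : Matrix (Fin 3) (Fin 3) ℝ} (hR : Rᵀ * R = 1)
    (p : Fin 3 → ℝ) (π : Fin 10 → ℝ) :
    ∃ π', wedge π' =
      (reindex (finSumFinEquiv : Fin 3 ⊕ Fin 3 ≃ Fin 6)
        (finSumFinEquiv : Fin 3 ⊕ Fin 3 ≃ Fin 6)
        (fromBlocks R 0 (-(R * skew3 p)) R))ᵀ * wedge π *
      reindex (finSumFinEquiv : Fin 3 ⊕ Fin 3 ≃ Fin 6)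
        (finSumFinEquiv : Fin 3 ⊕ Fin 3 ≃ Fin 6)
        (fromBlocks R 0 (-(R * skew3 p)) R) := by
  set J : Matrix (Fin 3) (Fin 3) ℝ := !![π 4, π 5, π 6; π 5, π 7, π 8; π 6, π 8, π 9]
  have hJs : Jᵀ = J := by
    ext i j
    fin_cases i <;> fin_cases j <;> rfl
  have hS := skew3_transpose p
  have hH := skew3_transpose ![π 1, π 2, π 3]
  have hw : wedge π = reindex finSumFinEquiv finSumFinEquiv
      (fromBlocks J (skew3 ![π 1, π 2, π 3]) (skew3 ![π 1, π 2, π 3])ᵀ (π 0 • 1)) := rfl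
  rw [hw]
  generalize skew3 ![π 1, π 2, π 3] = H at hH ⊢
  generalize skew3 p = S at hS ⊢
  have hB : (Rᵀ * H * R + π 0 • S)ᵀ = -(Rᵀ * H * R + π 0 • S) := by
    simp [hS, hH, Matrix.mul_assoc]
    abel
  have hA : (Rᵀ * J * R - S * (Rᵀ * H * R) - Rᵀ * H * R * S - π 0 • (S * S)).IsSymm := by
    simp [Matrix.IsSymm, hS, hH, hJs, Matrix.mul_assoc]
    abel
  obtain ⟨π', hπ'⟩ := exists_wedge_eq (π 0) hA hB
  refine ⟨π', hπ'.trans ?_⟩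
  have hRS : Rᵀ * (R * S) = S := by rw [← Matrix.mul_assoc, hR, Matrix.one_mul]
  simp only [reindex_apply, transpose_submatrix, submatrix_mul_equiv, fromBlocks_transpose,
    fromBlocks_multiply]
  congr 2
  · simp [hS, hH, Matrix.mul_assoc, Matrix.add_mul, hRS]
    abel
  · simp [hS, Matrix.mul_assoc, Matrix.add_mul, hR]
  · simp [hS, hH, Matrix.mul_assoc, hRS]
  · simp [hR]

/-- Well-definedness of the parameter-transfer matrix `B(Xᵀ)`: for a spatial transform
`X = [[R, 0], [-R·S(p), R]]` with `R ∈ SO(3)` and `p ∈ ℝ³`, there is a unique linear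
map `B : ℝ^10 → ℝ^10` with `[B(π)]^∧ = Xᵀ·[π]^∧·X` for every `π`; in particular, for
every `π` there is a unique `π'` with `[π']^∧ = Xᵀ·[π]^∧·X`. -/
theorem parameter_transfer_map_wellDefined (R : Matrix (Fin 3) (Fin 3) ℝ) (p : Fin 3 → ℝ)
    (hR : Rᵀ * R = 1) (hdet : R.det = 1) :
    ∃! B : (Fin 10 → ℝ) →ₗ[ℝ] (Fin 10 → ℝ),
      ∀ π : Fin 10 → ℝ,
        wedge (B π) =
          (Matrix.reindex (finSumFinEquiv : Fin 3 ⊕ Fin 3 ≃ Fin 6)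
              (finSumFinEquiv : Fin 3 ⊕ Fin 3 ≃ Fin 6)
              (Matrix.fromBlocks R 0 (-(R * skew3 p)) R))ᵀ * wedge π *
            Matrix.reindex (finSumFinEquiv : Fin 3 ⊕ Fin 3 ≃ Fin 6)
              (finSumFinEquiv : Fin 3 ⊕ Fin 3 ≃ Fin 6)
              (Matrix.fromBlocks R 0 (-(R * skew3 p)) R) := by
  choose f hf using exists_wedge_eq_congruence hR p
  refine ⟨⟨⟨f, fun π π' => wedge_injective ?_⟩, fun c π => wedge_injective ?_⟩, hf,
    fun B hB => LinearMap.ext fun π => wedge_injective ((hB π).trans (hf π).symm)⟩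
  · rw [wedge_add, hf, hf, hf, wedge_add, Matrix.mul_add, Matrix.add_mul]
  · simp only [RingHom.id_apply]
    rw [wedge_smul, hf, hf, wedge_smul, Matrix.mul_smul, Matrix.smul_mul]
end
end
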